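/- arXiv:1202.1622 — 5 statements merged into one kernel-verified Lean document; each statement's English description precedes it below -/
import Mathlib

section
/- Fix ν ∈ I^α, 1 ≤ j ≤ m−1, x ∈ E_α, and complete I-graded flags F ∈ F_ν and F' ∈ F_{s_jν} with F_k = F'_k for all k ≠ j and F_j ≠ F'_j. Then F and F' are both strictly x-stable if and only if: x_a(F_k ∩ V_{out(a)}) ⊆ F_{k-1} ∩ V_{in(a)} for all a ∈ Ω and all k ∉ {j, j+1}, and x_a(F_{j+1} ∩ V_{out(a)}) ⊆ F_{j-1} ∩ V_{in(a)} for all a ∈ Ω. -/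
/-- `F` is a complete `I`-graded flag of type `ν` (0-indexed: the step from `F k` to
`F (k+1)` adds a line of degree `ν k`). -/
def IsTypedFlag {I V : Type*} [AddCommGroup V] [Module ℂ V]
    (Vgr : I → Submodule ℂ V) (m : ℕ) (ν : Fin m → I)
    (F : ℕ → Submodule ℂ V) : Prop :=
  F 0 = ⊥ ∧ F m = ⊤ ∧
    ∀ k : Fin m, ∃ v : V, v ∈ Vgr (ν k) ∧ v ∉ F (k : ℕ) ∧
      F ((k : ℕ) + 1) = F (k : ℕ) ⊔ Submodule.span ℂ {v}

/-- The flag `F` is strictly `x`-stable for a representation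
`x ∈ E_α = ⊕_{a ∈ Ω} Hom(V_{out a}, V_{in a})` of the quiver `(I, Ω)`:
`x_a (F_{k+1} ∩ V_{out a}) ⊆ F_k ∩ V_{in a}` for all arrows `a` and all `k < m`. -/
def StrictStable {I V : Type*} [AddCommGroup V] [Module ℂ V]
    (Vgr : I → Submodule ℂ V) {Ω : Type*} (qout qin : Ω → I) (m : ℕ)
    (x : ∀ a : Ω, ↥(Vgr (qout a)) →ₗ[ℂ] ↥(Vgr (qin a)))
    (F : ℕ → Submodule ℂ V) : Prop :=
  ∀ a : Ω, ∀ k < m, ∀ v : ↥(Vgr (qout a)), (v : V) ∈ F (k + 1) → ((x a v : V) ∈ F k)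

theorem IsTypedFlag.covBy {I V : Type*} [AddCommGroup V] [Module ℂ V]
    {Vgr : I → Submodule ℂ V} {m : ℕ} {ν : Fin m → I} {F : ℕ → Submodule ℂ V}
    (hF : IsTypedFlag Vgr m ν F) {k : ℕ} (hk : k < m) : F k ⋖ F (k + 1) := by
  obtain ⟨v, -, hv, h⟩ := hF.2.2 ⟨k, hk⟩
  rw [show F (k + 1) = F k ⊔ Submodule.span ℂ {v} from h, sup_comm]
  exact Submodule.covBy_span_singleton_sup hv

/-- Two distinct covers of the same element meet in that element. -/
theorem CovBy.inf_eq_of_ne {α : Type*} [Lattice α] {a b c : α}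
    (hb : a ⋖ b) (hc : a ⋖ c) (hne : b ≠ c) : b ⊓ c = a := by
  rcases hb.eq_or_eq (le_inf hb.le hc.le) inf_le_left with h | h
  · exact h
  · rcases hc.eq_or_eq hb.le (inf_eq_left.mp h) with h' | h'
    · exact absurd h' hb.lt.ne'
    · exact absurd h' hne

theorem stmt5 {I V : Type*} [DecidableEq I] [AddCommGroup V] [Module ℂ V]
    (Vgr : I → Submodule ℂ V) (hV : DirectSum.IsInternal Vgr)
    {Ω : Type*} (qout qin : Ω → I)
    (m : ℕ) (ν : Fin m → I) (j : ℕ) (hj : j + 1 < m)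
    (x : ∀ a : Ω, ↥(Vgr (qout a)) →ₗ[ℂ] ↥(Vgr (qin a)))
    (F F' : ℕ → Submodule ℂ V)
    (hF : IsTypedFlag Vgr m ν F)
    (hF' : IsTypedFlag Vgr m (ν ∘ Equiv.swap ⟨j, Nat.lt_of_succ_lt hj⟩ ⟨j + 1, hj⟩) F')
    (hagree : ∀ k ≤ m, k ≠ j + 1 → F k = F' k)
    (hdiff : F (j + 1) ≠ F' (j + 1)) :
    (StrictStable Vgr qout qin m x F ∧ StrictStable Vgr qout qin m x F') ↔
      ((∀ a : Ω, ∀ k < m, k ≠ j → k ≠ j + 1 →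
          ∀ v : ↥(Vgr (qout a)), (v : V) ∈ F (k + 1) → ((x a v : V) ∈ F k)) ∧
        (∀ a : Ω, ∀ v : ↥(Vgr (qout a)), (v : V) ∈ F (j + 2) → ((x a v : V) ∈ F j))) := by
  have hj0 : F j = F' j := hagree j (by omega) (by omega)
  have hj2 : F (j + 2) = F' (j + 2) := hagree (j + 2) (by omega) (by omega)
  constructor
  · rintro ⟨hs, hs'⟩
    refine ⟨fun a k hk _ _ => hs a k hk, fun a v hv => ?_⟩
    have hcov : F j ⋖ F' (j + 1) := hj0 ▸ hF'.covBy (by omega)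
    rw [← (hF.covBy (by omega : j < m)).inf_eq_of_ne hcov hdiff]
    exact ⟨hs a (j + 1) hj v hv, hs' a (j + 1) hj v (hj2 ▸ hv)⟩
  · rintro ⟨hout, hmid⟩
    constructor
    · intro a k hk v hv
      rcases eq_or_ne k j with rfl | h1
      · exact hmid a v ((hF.covBy hj).le hv)
      rcases eq_or_ne k (j + 1) with rfl | h2
      · exact (hF.covBy (by omega)).le (hmid a v hv)
      exact hout a k hk h1 h2 v hv
    · intro a k hk v hv
      rcases eq_or_ne k j with rfl | h1
      · exact hj0 ▸ hmid a v (hj2 ▸ (hF'.covBy hj).le hv)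
      rcases eq_or_ne k (j + 1) with rfl | h2
      · exact (hF'.covBy (by omega)).le (hj0 ▸ hmid a v (hj2 ▸ hv))
      rw [← hagree (k + 1) hk (by omega)] at hv
      rw [← hagree k hk.le h2]
      exact hout a k hk h1 h2 v hv
end

section
/- For any f ∈ A and any 1 ≤ t ≤ m−1, the composite operator identity P·∂_t(P·∂_t f) = ∂_t(P)·(P·∂_t f) holds, where P = ∏_{a=1}^{ℓ}(x_t − x_{t+1} + ℏ_a) and ∂_t(P) = (s_t P − P)/(x_t − x_{t+1}). Equivalently, the operator T_t : f ↦ P·∂_t f satisfies T_t ∘ T_t = ∂_t(P)·T_t. -/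
open MvPolynomial

/-- `P = ∏_{a=1}^{ℓ} (x_t − x_{t+1} + ℏ_a)` in `A = ℂ[ℏ_1,…,ℏ_ℓ][x_1,…,x_m]`. -/
noncomputable def Ppol (ℓ m t : ℕ) (ht : t + 1 < m) :
    MvPolynomial (Fin m) (MvPolynomial (Fin ℓ) ℂ) :=
  ∏ a : Fin ℓ, (X ⟨t, Nat.lt_of_succ_lt ht⟩ - X ⟨t + 1, ht⟩ + C (X a))

/-- The operator `T_t : f ↦ P·∂_t f` satisfies `T_t ∘ T_t = ∂_t(P)·T_t`, i.e.
`P·∂_t(P·∂_t f) = ∂_t(P)·(P·∂_t f)`.  Here divided differences are encoded by their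
defining property `(x_t − x_{t+1})·(∂_t h) = s_t h − h`. -/
theorem stmt11 (ℓ m t : ℕ) (ht : t + 1 < m)
    (f d₁ dP d₂ : MvPolynomial (Fin m) (MvPolynomial (Fin ℓ) ℂ))
    (hd₁ : (X ⟨t, Nat.lt_of_succ_lt ht⟩ - X ⟨t + 1, ht⟩) * d₁ =
      rename (⇑(Equiv.swap (⟨t, Nat.lt_of_succ_lt ht⟩ : Fin m) ⟨t + 1, ht⟩)) f - f)
    (hdP : (X ⟨t, Nat.lt_of_succ_lt ht⟩ - X ⟨t + 1, ht⟩) * dP =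
      rename (⇑(Equiv.swap (⟨t, Nat.lt_of_succ_lt ht⟩ : Fin m) ⟨t + 1, ht⟩)) (Ppol ℓ m t ht)
        - Ppol ℓ m t ht)
    (hd₂ : (X ⟨t, Nat.lt_of_succ_lt ht⟩ - X ⟨t + 1, ht⟩) * d₂ =
      rename (⇑(Equiv.swap (⟨t, Nat.lt_of_succ_lt ht⟩ : Fin m) ⟨t + 1, ht⟩))
          (Ppol ℓ m t ht * d₁) - Ppol ℓ m t ht * d₁) :
    Ppol ℓ m t ht * d₂ = dP * (Ppol ℓ m t ht * d₁) := by
  have hi : (⟨t, Nat.lt_of_succ_lt ht⟩ : Fin m) ≠ ⟨t + 1, ht⟩ := by simp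
  generalize (⟨t, Nat.lt_of_succ_lt ht⟩ : Fin m) = i at *
  generalize (⟨t + 1, ht⟩ : Fin m) = j at *
  have hX : (X i - X j : MvPolynomial (Fin m) (MvPolynomial (Fin ℓ) ℂ)) ≠ 0 :=
    sub_ne_zero.mpr fun h => hi (X_injective h)
  have hs : rename (Equiv.swap i j) d₁ = d₁ := by
    have h := congrArg (rename (Equiv.swap i j)) hd₁
    simp only [map_mul, map_sub, rename_X, Equiv.swap_apply_left, Equiv.swap_apply_right,
      rename_rename, ← Equiv.coe_trans, Equiv.swap_swap, Equiv.coe_refl, rename_id_apply] at h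
    exact mul_left_cancel₀ hX (by linear_combination -h - hd₁)
  rw [map_mul, hs] at hd₂
  have h : d₂ = dP * d₁ := mul_left_cancel₀ hX (by linear_combination hd₂ - d₁ * hdP)
  rw [h]
  ring
end

section
/- Let P(u,v) = ∏_{a=1}^{ℓ}(u − v + ℏ_a). Then the rational functions P̄'(u,v,w) = P(v,u)P(u,w)/((u−v)(u−w)) + P(u,w)P(v,w)/((u−w)(v−w)) − P(u,v)P(v,w)/((u−v)(v−w)) and P̄''(u,v,w) = −P(u,v)P(u,w)/((u−v)(u−w)) − P(u,w)P(w,v)/((u−w)(v−w)) + P(u,v)P(v,w)/((u−v)(v−w)) are polynomials, i.e., they lie in ℂ[ℏ_1,…,ℏ_ℓ][u,v,w]. -/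
open MvPolynomial

/-- `P(u,v) = ∏_{a=1}^{ℓ} (u − v + ℏ_a)` evaluated at two elements of
`ℂ[ℏ_1,…,ℏ_ℓ][u,v,w] = MvPolynomial (Fin 3) (MvPolynomial (Fin ℓ) ℂ)`. -/
noncomputable def P3 (ℓ : ℕ) (u v : MvPolynomial (Fin 3) (MvPolynomial (Fin ℓ) ℂ)) :
    MvPolynomial (Fin 3) (MvPolynomial (Fin ℓ) ℂ) :=
  ∏ a : Fin ℓ, (u - v + C (X a))

section Identify

variable {σ R : Type*} [DecidableEq σ] [CommRing R]

/-- The substitution `X i ↦ X j`, fixing the other variables. -/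
noncomputable def identify (i j : σ) : MvPolynomial σ R →ₐ[R] MvPolynomial σ R :=
  aeval (Function.update X i (X j))

theorem identify_X (i j k : σ) :
    identify i j (X k : MvPolynomial σ R) = if k = i then X j else X k := by
  simp [identify, Function.update_apply]

theorem X_sub_X_dvd_iff (i j : σ) (p : MvPolynomial σ R) :
    X i - X j ∣ p ↔ identify i j p = 0 := by
  constructor
  · rintro ⟨q, rfl⟩
    rw [map_mul, map_sub, identify_X, identify_X]
    by_cases h : j = i <;> simp [h]
  · intro h
    have key : (Ideal.Quotient.mkₐ R (Ideal.span {(X i - X j : MvPolynomial σ R)})).comp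
        (identify i j) = Ideal.Quotient.mkₐ R _ := by
      ext k
      by_cases hk : k = i
      · subst hk
        simpa [identify_X] using (Ideal.Quotient.eq.2 (Ideal.mem_span_singleton_self _)).symm
      · simp [identify_X, hk]
    have hp := DFunLike.congr_fun key p
    rw [AlgHom.comp_apply, h, map_zero] at hp
    exact Ideal.mem_span_singleton.1 (Ideal.Quotient.eq_zero_iff_mem.1 hp.symm)

theorem X_sub_X_mul_dvd [IsDomain R] {i j : σ} {a p : MvPolynomial σ R}
    (ha : ¬ X i - X j ∣ a) (hp : a ∣ p) (h : X i - X j ∣ p) : (X i - X j) * a ∣ p := by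
  obtain ⟨b, rfl⟩ := hp
  rw [X_sub_X_dvd_iff] at ha h
  rw [map_mul] at h
  rw [mul_comm]
  exact mul_dvd_mul_left a ((X_sub_X_dvd_iff i j b).2 ((mul_eq_zero.1 h).resolve_left ha))

end Identify

theorem X_sub_X_mul_X_sub_X_mul_X_sub_X_dvd {R : Type*} [CommRing R] [IsDomain R]
    {p : MvPolynomial (Fin 3) R} (h₀₁ : identify 0 1 p = 0) (h₀₂ : identify 0 2 p = 0)
    (h₁₂ : identify 1 2 p = 0) : (X 0 - X 1) * ((X 0 - X 2) * (X 1 - X 2)) ∣ p := by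
  have hne : ∀ {i j : Fin 3}, i ≠ j → (X i - X j : MvPolynomial (Fin 3) R) ≠ 0 :=
    fun h => sub_ne_zero.2 fun h' => h (X_injective h')
  rw [← X_sub_X_dvd_iff] at h₀₁ h₀₂ h₁₂
  refine X_sub_X_mul_dvd ?_ (X_sub_X_mul_dvd ?_ h₁₂ h₀₂) h₀₁
  all_goals simp [X_sub_X_dvd_iff, identify_X, hne]

theorem identify_P3 (ℓ : ℕ) (i j : Fin 3)
    (u v : MvPolynomial (Fin 3) (MvPolynomial (Fin ℓ) ℂ)) :
    identify i j (P3 ℓ u v) = P3 ℓ (identify i j u) (identify i j v) := by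
  simp [P3, identify]

theorem P3_self (ℓ : ℕ) (u v : MvPolynomial (Fin 3) (MvPolynomial (Fin ℓ) ℂ)) :
    P3 ℓ u u = P3 ℓ v v := by
  simp [P3]

/-- The rational functions `P̄'(u,v,w)` and `P̄''(u,v,w)` are polynomials: there exist
polynomials `p`, `q` such that `(u−v)(u−w)(v−w)·p` resp. `(u−v)(u−w)(v−w)·q` equals the
corresponding numerator (here `u = X 0`, `v = X 1`, `w = X 2`). -/
theorem stmt13 (ℓ : ℕ) :
    ∃ p q : MvPolynomial (Fin 3) (MvPolynomial (Fin ℓ) ℂ),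
      ((X 0 - X 1) * ((X 0 - X 2) * (X 1 - X 2))) * p =
        P3 ℓ (X 1) (X 0) * P3 ℓ (X 0) (X 2) * (X 1 - X 2)
          + P3 ℓ (X 0) (X 2) * P3 ℓ (X 1) (X 2) * (X 0 - X 1)
          - P3 ℓ (X 0) (X 1) * P3 ℓ (X 1) (X 2) * (X 0 - X 2) ∧
      ((X 0 - X 1) * ((X 0 - X 2) * (X 1 - X 2))) * q =
        -(P3 ℓ (X 0) (X 1) * P3 ℓ (X 0) (X 2) * (X 1 - X 2))
          - P3 ℓ (X 0) (X 2) * P3 ℓ (X 2) (X 1) * (X 0 - X 1)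
          + P3 ℓ (X 0) (X 1) * P3 ℓ (X 1) (X 2) * (X 0 - X 2) := by
  have hself := fun i => P3_self ℓ (X i) (X 0)
  refine ⟨_, _, (X_sub_X_mul_X_sub_X_mul_X_sub_X_dvd ?_ ?_ ?_).choose_spec.symm,
    (X_sub_X_mul_X_sub_X_mul_X_sub_X_dvd ?_ ?_ ?_).choose_spec.symm⟩
  all_goals
    simp [identify_P3, identify_X, hself] <;> ring
end

section
/- Let A = ℂ[ℏ_1,…,ℏ_ℓ][x_1,x_2,x_3], P(u,v) = ∏_{a=1}^{ℓ}(u − v + ℏ_a), and define T_1 f = P(x_1,x_2)·∂_1 f and T_2 f = P(x_2,x_3)·∂_2 f. Then for every f ∈ A: (T_2 ∘ T_1 ∘ T_2)(f) − (T_1 ∘ T_2 ∘ T_1)(f) = P̄'(x_1,x_2,x_3)·T_1(f) + P̄''(x_1,x_2,x_3)·T_2(f), where P̄'(u,v,w) = P(v,u)P(u,w)/((u−v)(u−w)) + P(u,w)P(v,w)/((u−w)(v−w)) − P(u,v)P(v,w)/((u−v)(v−w)) and P̄''(u,v,w) = −P(u,v)P(u,w)/((u−v)(u−w)) − P(u,w)P(w,v)/((u−w)(v−w))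 + P(u,v)P(v,w)/((u−v)(v−w)) (both are polynomials). -/
open MvPolynomial

theorem rename_P3 (ℓ : ℕ) (σ : Fin 3 → Fin 3)
    (u v : MvPolynomial (Fin 3) (MvPolynomial (Fin ℓ) ℂ)) :
    rename σ (P3 ℓ u v) = P3 ℓ (rename σ u) (rename σ v) := by
  simp [P3, map_prod]

theorem X_sub_X_ne_zero {σ R : Type*} [CommRing R] [Nontrivial R] {i j : σ} (h : i ≠ j) :
    (X i - X j : MvPolynomial σ R) ≠ 0 :=
  sub_ne_zero.2 fun hX => h (X_injective hX)

/-- A divided difference of `f` along the transposition `(i j)` is invariant under `(i j)`. -/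
theorem rename_swap_eq_of_mul_eq {σ R : Type*} [DecidableEq σ] [CommRing R] [IsDomain R]
    {i j : σ} (h : i ≠ j) {f d : MvPolynomial σ R}
    (hd : (X i - X j) * d = rename (⇑(Equiv.swap i j)) f - f) :
    rename (⇑(Equiv.swap i j)) d = d := by
  have hs := congrArg (rename (⇑(Equiv.swap i j))) hd
  simp only [map_mul, map_sub, rename_X, rename_rename, Equiv.swap_apply_left,
    Equiv.swap_apply_right, ← Equiv.coe_trans, Equiv.swap_swap, Equiv.coe_refl, rename_id_apply]
    at hs
  refine mul_left_cancel₀ (X_sub_X_ne_zero h) ?_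
  linear_combination -hs - hd

/-- The braid relation for `T_t f = P(x_t,x_{t+1})·∂_t f`:
`(T₂T₁T₂ − T₁T₂T₁) f = P̄'(x₁,x₂,x₃)·T₁ f + P̄''(x₁,x₂,x₃)·T₂ f`.
Here `x₁,x₂,x₃ = X 0, X 1, X 2`; divided differences are encoded by their defining
property, and `P̄', P̄''` by the cleared-denominator identities of their definitions. -/
theorem stmt14 (ℓ : ℕ)
    (f d₁ d₂ d₃ e₁ e₂ e₃ p q : MvPolynomial (Fin 3) (MvPolynomial (Fin ℓ) ℂ))
    -- P̄' and P̄''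
    (hp : ((X 0 - X 1) * ((X 0 - X 2) * (X 1 - X 2))) * p =
      P3 ℓ (X 1) (X 0) * P3 ℓ (X 0) (X 2) * (X 1 - X 2)
        + P3 ℓ (X 0) (X 2) * P3 ℓ (X 1) (X 2) * (X 0 - X 1)
        - P3 ℓ (X 0) (X 1) * P3 ℓ (X 1) (X 2) * (X 0 - X 2))
    (hq : ((X 0 - X 1) * ((X 0 - X 2) * (X 1 - X 2))) * q =
      -(P3 ℓ (X 0) (X 1) * P3 ℓ (X 0) (X 2) * (X 1 - X 2))
        - P3 ℓ (X 0) (X 2) * P3 ℓ (X 2) (X 1) * (X 0 - X 1)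
        + P3 ℓ (X 0) (X 1) * P3 ℓ (X 1) (X 2) * (X 0 - X 2))
    -- T₂ T₁ T₂ f = P(x₂,x₃) * d₃
    (hd₁ : (X 1 - X 2) * d₁ = rename (⇑(Equiv.swap (1 : Fin 3) 2)) f - f)
    (hd₂ : (X 0 - X 1) * d₂ =
      rename (⇑(Equiv.swap (0 : Fin 3) 1)) (P3 ℓ (X 1) (X 2) * d₁) - P3 ℓ (X 1) (X 2) * d₁)
    (hd₃ : (X 1 - X 2) * d₃ =
      rename (⇑(Equiv.swap (1 : Fin 3) 2)) (P3 ℓ (X 0) (X 1) * d₂) - P3 ℓ (X 0) (X 1) * d₂)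
    -- T₁ T₂ T₁ f = P(x₁,x₂) * e₃
    (he₁ : (X 0 - X 1) * e₁ = rename (⇑(Equiv.swap (0 : Fin 3) 1)) f - f)
    (he₂ : (X 1 - X 2) * e₂ =
      rename (⇑(Equiv.swap (1 : Fin 3) 2)) (P3 ℓ (X 0) (X 1) * e₁) - P3 ℓ (X 0) (X 1) * e₁)
    (he₃ : (X 0 - X 1) * e₃ =
      rename (⇑(Equiv.swap (0 : Fin 3) 1)) (P3 ℓ (X 1) (X 2) * e₂) - P3 ℓ (X 1) (X 2) * e₂) :
    P3 ℓ (X 1) (X 2) * d₃ - P3 ℓ (X 0) (X 1) * e₃ =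
      p * (P3 ℓ (X 0) (X 1) * e₁) + q * (P3 ℓ (X 1) (X 2) * d₁) := by
  have h01 : Equiv.swap (0 : Fin 3) 1 2 = 2 := by decide
  have h12 : Equiv.swap (1 : Fin 3) 2 0 = 0 := by decide
  have hbraid : rename (⇑(Equiv.swap (1 : Fin 3) 2)) (rename (⇑(Equiv.swap (0 : Fin 3) 1))
        (rename (⇑(Equiv.swap (1 : Fin 3) 2)) f)) =
      rename (⇑(Equiv.swap (0 : Fin 3) 1)) (rename (⇑(Equiv.swap (1 : Fin 3) 2))
        (rename (⇑(Equiv.swap (0 : Fin 3) 1)) f)) := by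
    simp only [rename_rename]
    congr 2
    decide
  have hd₁_symm := rename_swap_eq_of_mul_eq (by decide) hd₁
  have he₁_symm := rename_swap_eq_of_mul_eq (by decide) he₁
  have hd₁s := congrArg (rename (⇑(Equiv.swap (0 : Fin 3) 1))) hd₁
  have hd₁ss := congrArg (rename (⇑(Equiv.swap (1 : Fin 3) 2))) hd₁s
  have hd₂s := congrArg (rename (⇑(Equiv.swap (1 : Fin 3) 2))) hd₂
  have he₁s := congrArg (rename (⇑(Equiv.swap (1 : Fin 3) 2))) he₁
  have he₁ss := congrArg (rename (⇑(Equiv.swap (0 : Fin 3) 1))) he₁s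
  have he₂s := congrArg (rename (⇑(Equiv.swap (0 : Fin 3) 1))) he₂
  simp only [map_mul, map_sub, rename_X, rename_P3, Equiv.swap_apply_left,
    Equiv.swap_apply_right, h01, h12, hbraid, hd₁_symm, he₁_symm]
    at hd₁s hd₁ss hd₂ hd₂s hd₃ he₁s he₁ss he₂ he₂s he₃
  have h : ((X 0 - X 1) * ((X 0 - X 2) * (X 1 - X 2)) :
      MvPolynomial (Fin 3) (MvPolynomial (Fin ℓ) ℂ)) ≠ 0 :=
    mul_ne_zero (X_sub_X_ne_zero (by decide))
      (mul_ne_zero (X_sub_X_ne_zero (by decide)) (X_sub_X_ne_zero (by decide)))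
  refine mul_left_cancel₀ h ?_
  set A := P3 ℓ (X 0) (X 1)
  set B := P3 ℓ (X 1) (X 2)
  set K := P3 ℓ (X 0) (X 2)
  linear_combination
    (X 0 - X 1) * (X 0 - X 2) * B * hd₃ + (X 0 - X 1) * K * B * hd₂s
      + A * B * K * hd₁ss - (X 0 - X 2) * A * B * hd₂ - A * B * K * hd₁s
      - (X 1 - X 2) * (X 0 - X 2) * A * he₃ - (X 1 - X 2) * K * A * he₂s
      - A * B * K * he₁ss + (X 0 - X 2) * A * B * he₂ + A * B * K * he₁s
      - A * e₁ * hp - B * d₁ * hq + A * B * K * (hd₁ - he₁)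
end

section
/- Let Λ_{ii}, Λ_{ij}, Λ_{ji} be disjoint finite sets, ℍ = ℂ[ℏ_a : a ∈ Λ_{ii} ⊔ Λ_{ij} ⊔ Λ_{ji}], and A = ℍ[x_1,x_2,x_3]. Set P(u,v) = ∏_{a∈Λ_{ii}}(u − v + ℏ_a), g_{ij}(u,v) = ∏_{a∈Λ_{ij}}(u − v + ℏ_a), g_{ji}(u,v) = ∏_{a∈Λ_{ji}}(u − v + ℏ_a), and Q(u,v) = g_{ij}(v,u)·g_{ji}(u,v). Then for every f ∈ A: g_{ij}(x_2,x_3)·s_2[ P(x_1,x_2)·∂_1( g_{ji}(x_2,x_3)·s_2 f ) ] − g_{ji}(x_1,x_2)·s_1[ P(x_2,x_3)·∂_2( g_{ij}(x_1,x_2)·s_1 f ) ] = P(x_1,x_3)·((Q(x_1,x_2) − Q(x_3,x_2))/(x_1 − x_3))·f. (This is the verification, in the polynomial representation, of the KLR braid relation (r_{t+1}r_t r_{t+1} − r_t r_{t+1} r_t) e(ν) = P_i(x_t,x_{t+2}) Q̄_{i,j}(x_t,x_{t+1},x_{t+2}) e(ν) for ν_t = ν_{t+2} = i ≠ j = ν_{t+1}.)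 -/
open MvPolynomial

section

variable (Λii Λij Λji : Type) [Fintype Λii] [Fintype Λij] [Fintype Λji]

/-- `A = ℍ[x₁,x₂,x₃]` with `ℍ = ℂ[ℏ_a : a ∈ Λii ⊔ Λij ⊔ Λji]`; `x₁,x₂,x₃ = X 0, X 1, X 2`. -/
abbrev KA : Type := MvPolynomial (Fin 3) (MvPolynomial (Λii ⊕ Λij ⊕ Λji) ℂ)

/-- `P(u,v) = ∏_{a ∈ Λii} (u − v + ℏ_a)`. -/
noncomputable def Pii (u v : KA Λii Λij Λji) : KA Λii Λij Λji :=
  ∏ a : Λii, (u - v + C (X (Sum.inl a)))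

/-- `g_{ij}(u,v) = ∏_{a ∈ Λij} (u − v + ℏ_a)`. -/
noncomputable def Gij (u v : KA Λii Λij Λji) : KA Λii Λij Λji :=
  ∏ a : Λij, (u - v + C (X (Sum.inr (Sum.inl a))))

/-- `g_{ji}(u,v) = ∏_{a ∈ Λji} (u − v + ℏ_a)`. -/
noncomputable def Gji (u v : KA Λii Λij Λji) : KA Λii Λij Λji :=
  ∏ a : Λji, (u - v + C (X (Sum.inr (Sum.inr a))))

/-- `Q(u,v) = g_{ij}(v,u)·g_{ji}(u,v)`. -/
noncomputable def Qq (u v : KA Λii Λij Λji) : KA Λii Λij Λji :=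
  Gij Λii Λij Λji v u * Gji Λii Λij Λji u v

theorem rename_Pii (σ : Fin 3 → Fin 3) (i j : Fin 3) :
    rename σ (Pii Λii Λij Λji (X i) (X j)) = Pii Λii Λij Λji (X (σ i)) (X (σ j)) := by
  simp [Pii, map_prod]

theorem rename_Gij (σ : Fin 3 → Fin 3) (i j : Fin 3) :
    rename σ (Gij Λii Λij Λji (X i) (X j)) = Gij Λii Λij Λji (X (σ i)) (X (σ j)) := by
  simp [Gij, map_prod]

theorem rename_Gji (σ : Fin 3 → Fin 3) (i j : Fin 3) :
    rename σ (Gji Λii Λij Λji (X i) (X j)) = Gji Λii Λij Λji (X (σ i)) (X (σ j)) := by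
  simp [Gji, map_prod]

theorem swap_braid_comp :
    ⇑(Equiv.swap (1 : Fin 3) 2) ∘ ⇑(Equiv.swap (0 : Fin 3) 1) ∘ ⇑(Equiv.swap (1 : Fin 3) 2) =
      ⇑(Equiv.swap (0 : Fin 3) 1) ∘ ⇑(Equiv.swap (1 : Fin 3) 2) ∘ ⇑(Equiv.swap (0 : Fin 3) 1) := by
  decide

/-- The verification, in the polynomial representation, of the KLR braid relation for
`ν_t = ν_{t+2} = i ≠ j = ν_{t+1}`:
`g_{ij}(x₂,x₃)·s₂[P(x₁,x₂)·∂₁(g_{ji}(x₂,x₃)·s₂ f)] − g_{ji}(x₁,x₂)·s₁[P(x₂,x₃)·∂₂(g_{ij}(x₁,x₂)·s₁ f)]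
  = P(x₁,x₃)·((Q(x₁,x₂) − Q(x₃,x₂))/(x₁ − x₃))·f`.
Divided differences and the quotient `(Q(x₁,x₂) − Q(x₃,x₂))/(x₁ − x₃)` are encoded by
their defining identities. -/
theorem stmt15 (f d₁ d₂ qq : KA Λii Λij Λji)
    (hd₁ : (X 0 - X 1) * d₁ =
      rename (⇑(Equiv.swap (0 : Fin 3) 1))
          (Gji Λii Λij Λji (X 1) (X 2) * rename (⇑(Equiv.swap (1 : Fin 3) 2)) f)
        - Gji Λii Λij Λji (X 1) (X 2) * rename (⇑(Equiv.swap (1 : Fin 3) 2)) f)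
    (hd₂ : (X 1 - X 2) * d₂ =
      rename (⇑(Equiv.swap (1 : Fin 3) 2))
          (Gij Λii Λij Λji (X 0) (X 1) * rename (⇑(Equiv.swap (0 : Fin 3) 1)) f)
        - Gij Λii Λij Λji (X 0) (X 1) * rename (⇑(Equiv.swap (0 : Fin 3) 1)) f)
    (hqq : (X 0 - X 2) * qq =
      Qq Λii Λij Λji (X 0) (X 1) - Qq Λii Λij Λji (X 2) (X 1)) :
    Gij Λii Λij Λji (X 1) (X 2) *
        rename (⇑(Equiv.swap (1 : Fin 3) 2)) (Pii Λii Λij Λji (X 0) (X 1) * d₁)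
      - Gji Λii Λij Λji (X 0) (X 1) *
        rename (⇑(Equiv.swap (0 : Fin 3) 1)) (Pii Λii Λij Λji (X 1) (X 2) * d₂)
      = Pii Λii Λij Λji (X 0) (X 2) * qq * f := by
  have s₁0 : Equiv.swap (0 : Fin 3) 1 0 = 1 := by decide
  have s₁1 : Equiv.swap (0 : Fin 3) 1 1 = 0 := by decide
  have s₁2 : Equiv.swap (0 : Fin 3) 1 2 = 2 := by decide
  have s₂0 : Equiv.swap (1 : Fin 3) 2 0 = 0 := by decide
  have s₂1 : Equiv.swap (1 : Fin 3) 2 1 = 2 := by decide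
  have s₂2 : Equiv.swap (1 : Fin 3) 2 2 = 1 := by decide
  have inv₁ : ⇑(Equiv.swap (0 : Fin 3) 1) ∘ ⇑(Equiv.swap (0 : Fin 3) 1) = id := by decide
  have inv₂ : ⇑(Equiv.swap (1 : Fin 3) 2) ∘ ⇑(Equiv.swap (1 : Fin 3) 2) = id := by decide
  have h₁ := congrArg (rename ⇑(Equiv.swap (1 : Fin 3) 2)) hd₁
  have h₂ := congrArg (rename ⇑(Equiv.swap (0 : Fin 3) 1)) hd₂
  simp only [map_mul, map_sub, rename_X, rename_Gij, rename_Gji, rename_rename, s₁0, s₁1, s₁2,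
    s₂0, s₂1, s₂2, inv₁, inv₂, rename_id_apply, swap_braid_comp] at h₁ h₂
  simp only [map_mul, rename_Pii, s₁1, s₁2, s₂0, s₂1]
  simp only [Qq] at hqq
  have hne : (X 0 - X 2 : KA Λii Λij Λji) ≠ 0 :=
    sub_ne_zero.mpr fun h => absurd (X_injective h) (by decide)
  apply mul_left_cancel₀ hne
  linear_combination
    Gij Λii Λij Λji (X 1) (X 2) * Pii Λii Λij Λji (X 0) (X 2) * h₁
      - Gji Λii Λij Λji (X 0) (X 1) * Pii Λii Λij Λji (X 0) (X 2) * h₂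
      - Pii Λii Λij Λji (X 0) (X 2) * f * hqq

end
end
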